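/- Let (C•,d) be a cochain complex in 𝒞 with graded lift C̄• along F, and let d̄, d̄′ be two differentials on C̄• with F(d̄) = F(d̄′) = d. Then: (i) ∂ = d̄′ − d̄ satisfies F(∂) = 0 and d̄∘∂ + ∂∘d̄ = 0; (ii) conversely, for any graded map ∂ of degree 1 with F(∂) = 0 and d̄∘∂ + ∂∘d̄ = 0, d̄ + ∂ is again a differential on C̄• lifting d; and (iii) there exists an isomorphism of cochain complexes (C̄•,d̄) → (C̄•,d̄′) whose image under F is the identity of (C•,d) if and only if d̄′ − d̄ = ε∘d̄ − d̄′∘ε for some graded map ε of degree 0 with F(ε) = 0. -/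

import Mathlib

open CategoryTheory

namespace Paper

/-- A graded object: a `ℤ`-indexed family of objects. -/
abbrev GradedObj (A : Type*) [Category A] := ℤ → A

/-- A graded map of degree `n` from `X` to `Y`. -/
abbrev GMap {A : Type*} [Category A] (X Y : GradedObj A) (n : ℤ) :=
  ∀ i : ℤ, X i ⟶ Y (i + n)

/-- Composition of graded maps, in diagrammatic order (`gcomp h f g` is "`g ∘ f`"),
with prescribed total degree `k = n + m`. -/
def gcomp {A : Type*} [Category A] {X Y Z : GradedObj A} {n m k : ℤ} (h : n + m = k)
    (f : GMap X Y n) (g : GMap Y Z m) : GMap X Z k :=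
  fun i => f i ≫ g (i + n) ≫ eqToHom (congrArg Z (show i + n + m = i + k by omega))

/-- The identity graded map of degree `0`. -/
def gid {A : Type*} [Category A] (X : GradedObj A) : GMap X X 0 :=
  fun i => eqToHom (congrArg X (add_zero i).symm)

/-- `δ(f) = d_Y ∘ f - (-1)ⁿ ⬝ f ∘ d_X` for pre-differentials `d_X`, `d_Y` and a graded
map `f` of degree `n`; the result has degree `m = n + 1`. -/
def gdelta {A : Type*} [Category A] [Preadditive A] {X Y : GradedObj A}
    (dX : GMap X X 1) (dY : GMap Y Y 1) {n m : ℤ} (h : n + 1 = m) (f : GMap X Y n) :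
    GMap X Y m :=
  gcomp h f dY - (n.negOnePow : ℤ) • gcomp (show 1 + n = m by omega) dX f

/-- The image of a graded object under a functor. -/
abbrev Fgr {A B : Type*} [Category A] [Category B] (F : B ⥤ A) (X : GradedObj B) :
    GradedObj A := fun i => F.obj (X i)

/-- The image of a graded map under a functor. -/
def Fmap {A B : Type*} [Category A] [Category B] (F : B ⥤ A) {X Y : GradedObj B} {n : ℤ}
    (f : GMap X Y n) : GMap (Fgr F X) (Fgr F Y) n := fun i => F.map (f i)

/-- `Ker(F)² = 0`: the composite of two `F`-killed morphisms vanishes. -/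
def KerSq {A B : Type*} [Category A] [Category B] [Preadditive A] [Preadditive B]
    (F : B ⥤ A) : Prop :=
  ∀ ⦃X Y Z : B⦄ (u : X ⟶ Y) (v : Y ⟶ Z), F.map u = 0 → F.map v = 0 → u ≫ v = 0

/-- `f : (X,dX) → (Y,dY)` and `g : (Y,dY) → (X,dX)` are cochain maps which are homotopy
inverse to each other. -/
def IsHomotopyEquivPair {A : Type*} [Category A] [Preadditive A] {X Y : GradedObj A}
    (dX : GMap X X 1) (dY : GMap Y Y 1) (f : GMap X Y 0) (g : GMap Y X 0) : Prop :=
  gdelta dX dY (show (0:ℤ) + 1 = 1 by omega) f = 0 ∧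
  gdelta dY dX (show (0:ℤ) + 1 = 1 by omega) g = 0 ∧
  (∃ H : GMap X X (-1), gdelta dX dX (show (-1:ℤ) + 1 = 0 by omega) H
      = gid X - gcomp (show (0:ℤ) + 0 = 0 by omega) f g) ∧
  (∃ K : GMap Y Y (-1), gdelta dY dY (show (-1:ℤ) + 1 = 0 by omega) K
      = gid Y - gcomp (show (0:ℤ) + 0 = 0 by omega) g f)


section GradedCalculus

variable {A : Type*} [Category A]

theorem GMap.eqToHom_comp_comp_eqToHom {X Y : GradedObj A} {n : ℤ} (f : GMap X Y n) {i j : ℤ}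
    (h : i = j) :
    eqToHom (congrArg X h) ≫ f j ≫ eqToHom (congrArg Y (show j + n = i + n by rw [h])) = f i := by
  subst h
  simp

theorem gid_gcomp {X Y : GradedObj A} {n : ℤ} (h : 0 + n = n) (f : GMap X Y n) :
    gcomp h (gid X) f = f :=
  funext fun i => f.eqToHom_comp_comp_eqToHom (add_zero i).symm

theorem gcomp_gid {X Y : GradedObj A} {n : ℤ} (h : n + 0 = n) (f : GMap X Y n) :
    gcomp h f (gid Y) = f := by
  funext i
  simp [gcomp, gid]

variable [Preadditive A] {X Y Z : GradedObj A} {n m k : ℤ} (h : n + m = k)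

theorem add_gcomp (f f' : GMap X Y n) (g : GMap Y Z m) :
    gcomp h (f + f') g = gcomp h f g + gcomp h f' g := by
  funext i
  simp [gcomp]

theorem gcomp_add (f : GMap X Y n) (g g' : GMap Y Z m) :
    gcomp h f (g + g') = gcomp h f g + gcomp h f g' := by
  funext i
  simp [gcomp]

theorem sub_gcomp (f f' : GMap X Y n) (g : GMap Y Z m) :
    gcomp h (f - f') g = gcomp h f g - gcomp h f' g := by
  funext i
  simp [gcomp]

theorem gcomp_sub (f : GMap X Y n) (g g' : GMap Y Z m) :
    gcomp h f (g - g') = gcomp h f g - gcomp h f g' := by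
  funext i
  simp [gcomp]

end GradedCalculus

section Functoriality

variable {A B : Type*} [Category A] [Category B] (F : B ⥤ A)

theorem Fmap_gid (X : GradedObj B) : Fmap F (gid X) = gid (Fgr F X) :=
  funext fun _ => eqToHom_map F _

variable [Preadditive A] [Preadditive B]

theorem Fmap_add [F.Additive] {X Y : GradedObj B} {n : ℤ} (f g : GMap X Y n) :
    Fmap F (f + g) = Fmap F f + Fmap F g :=
  funext fun _ => F.map_add

theorem Fmap_sub [F.Additive] {X Y : GradedObj B} {n : ℤ} (f g : GMap X Y n) :
    Fmap F (f - g) = Fmap F f - Fmap F g :=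
  funext fun _ => F.map_sub

variable {F}

theorem KerSq.gcomp_eq_zero (hF : KerSq F) {X Y Z : GradedObj B} {n m k : ℤ} (h : n + m = k)
    {f : GMap X Y n} {g : GMap Y Z m} (hf : Fmap F f = 0) (hg : Fmap F g = 0) :
    gcomp h f g = 0 := by
  funext i
  have hfg : f i ≫ g (i + n) = 0 := hF _ _ (congrFun hf i) (congrFun hg (i + n))
  rw [gcomp, ← Category.assoc, hfg, Limits.zero_comp]
  rfl

end Functoriality

/-- two lifted differentials on a fixed graded lift differ by an `F`-killed
degree-one map anticommuting with `d̄`; conversely adding such a map to `d̄` gives again a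
lifted differential; and the two lifted complexes are isomorphic over the identity iff
`d̄′ − d̄ = ε∘d̄ − d̄′∘ε` for some `F`-killed `ε` of degree `0`. -/
theorem statement6 {B C : Type*} [Category B] [Preadditive B] [Category C] [Preadditive C]
    (F : B ⥤ C) [F.Additive] [F.Full] (hF : KerSq F)
    (Xb : GradedObj B)
    (d : GMap (Fgr F Xb) (Fgr F Xb) 1)
    (hd : gcomp (show (1:ℤ) + 1 = 2 by omega) d d = 0)
    (db db' : GMap Xb Xb 1) (hdb : Fmap F db = d) (hdb' : Fmap F db' = d)
    (hdbsq : gcomp (show (1:ℤ) + 1 = 2 by omega) db db = 0)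
    (hdbsq' : gcomp (show (1:ℤ) + 1 = 2 by omega) db' db' = 0) :
    -- (i)
    (Fmap F (db' - db) = 0 ∧
      gcomp (show (1:ℤ) + 1 = 2 by omega) (db' - db) db
        + gcomp (show (1:ℤ) + 1 = 2 by omega) db (db' - db) = 0) ∧
    -- (ii)
    (∀ p : GMap Xb Xb 1, Fmap F p = 0 →
      gcomp (show (1:ℤ) + 1 = 2 by omega) p db
        + gcomp (show (1:ℤ) + 1 = 2 by omega) db p = 0 →
      (Fmap F (db + p) = d ∧
        gcomp (show (1:ℤ) + 1 = 2 by omega) (db + p) (db + p) = 0)) ∧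
    -- (iii)
    ((∃ u : GMap Xb Xb 0,
        Fmap F u = gid (Fgr F Xb) ∧
        gcomp (show (0:ℤ) + 1 = 1 by omega) u db'
          = gcomp (show (1:ℤ) + 0 = 1 by omega) db u ∧
        (∃ v : GMap Xb Xb 0,
          gcomp (show (0:ℤ) + 0 = 0 by omega) u v = gid Xb ∧
          gcomp (show (0:ℤ) + 0 = 0 by omega) v u = gid Xb)) ↔
      (∃ ε : GMap Xb Xb 0, Fmap F ε = 0 ∧
        db' - db = gcomp (show (1:ℤ) + 0 = 1 by omega) db ε
          - gcomp (show (0:ℤ) + 1 = 1 by omega) ε db')) := by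
  have hsub : Fmap F (db' - db) = 0 := by rw [Fmap_sub, hdb, hdb', sub_self]
  refine ⟨⟨hsub, ?_⟩, fun p hp hanti => ⟨by rw [Fmap_add, hdb, hp, add_zero], ?_⟩, ?_, ?_⟩
  · have hsq := hF.gcomp_eq_zero (show (1:ℤ) + 1 = 2 by omega) hsub hsub
    simp only [sub_gcomp, gcomp_sub, hdbsq, hdbsq'] at hsq ⊢
    refine neg_eq_zero.mp (Eq.trans ?_ hsq)
    abel
  · have hsq := hF.gcomp_eq_zero (show (1:ℤ) + 1 = 2 by omega) hp hp
    rw [add_gcomp, gcomp_add, gcomp_add, hdbsq, hsq, zero_add, add_zero, add_comm, hanti]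
  · rintro ⟨u, hu, hcomm, -⟩
    refine ⟨u - gid Xb, by rw [Fmap_sub, hu, Fmap_gid, sub_self], ?_⟩
    rw [gcomp_sub, sub_gcomp, gid_gcomp, gcomp_gid, hcomm]
    abel
  · rintro ⟨ε, hε, heq⟩
    have hsq := hF.gcomp_eq_zero (show (0:ℤ) + 0 = 0 by omega) hε hε
    refine ⟨gid Xb + ε, by rw [Fmap_add, hε, Fmap_gid, add_zero], ?_, gid Xb - ε, ?_, ?_⟩
    · rw [add_gcomp, gcomp_add, gid_gcomp, gcomp_gid]
      rw [sub_eq_sub_iff_add_eq_add] at heq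
      rw [heq, add_comm]
    · rw [add_gcomp, gcomp_sub, gcomp_sub, gid_gcomp, gid_gcomp, gcomp_gid, hsq]
      abel
    · rw [sub_gcomp, gcomp_add, gcomp_add, gid_gcomp, gid_gcomp, gcomp_gid, hsq]
      abel

end Paper
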